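/- arXiv:math/0611575 — 3 statements merged into one kernel-verified Lean document; each statement's English description precedes it below -/
import Mathlib

section
/- Let G be a finitely generated group that contains a subgroup of finite index isomorphic to ℤⁿ for some n ≥ 1 (a euclidean group). Then for every finite generating set A of G there is a uniform bound on the depth of elements of G with respect to A. -/
/-- The word length of `g` with respect to a generating set `A`. -/
noncomputable def wordLength {G : Type*} [Group G] (A : Set G) (g : G) : ℕ :=
  sInf {n | ∃ w : List G, w.length = n ∧ (∀ x ∈ w, x ∈ A ∨ x⁻¹ ∈ A) ∧ w.prod = g}

/-- The word metric with respect to `A`. -/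
noncomputable def wordDist {G : Type*} [Group G] (A : Set G) (g h : G) : ℕ :=
  wordLength A (g⁻¹ * h)

open scoped IsMulCommutative

section WordLength

variable {G : Type*} [Group G] {A : Set G}

theorem wordLength_prod_le {w : List G} (hw : ∀ x ∈ w, x ∈ A ∨ x⁻¹ ∈ A) :
    wordLength A w.prod ≤ w.length :=
  Nat.sInf_le ⟨w, rfl, hw, rfl⟩

theorem wordLength_one : wordLength A (1 : G) = 0 :=
  Nat.le_zero.1 (wordLength_prod_le (A := A) (w := []) (by simp))

theorem exists_word_of_closure_eq_top (hA : Subgroup.closure A = ⊤) (g : G) :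
    ∃ w : List G, w.length = wordLength A g ∧ (∀ x ∈ w, x ∈ A ∨ x⁻¹ ∈ A) ∧ w.prod = g := by
  have hg : g ∈ (Subgroup.closure A).toSubmonoid := by simp [hA]
  rw [Subgroup.closure_toSubmonoid] at hg
  obtain ⟨w, hw, hprod⟩ := Submonoid.exists_list_of_mem_closure hg
  exact Nat.sInf_mem
    (s := {n | ∃ w : List G, w.length = n ∧ (∀ x ∈ w, x ∈ A ∨ x⁻¹ ∈ A) ∧ w.prod = g})
    ⟨_, w, rfl, hw, hprod⟩

theorem wordLength_eq_zero (hA : Subgroup.closure A = ⊤) {g : G} (hg : wordLength A g = 0) :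
    g = 1 := by
  obtain ⟨w, hlen, -, rfl⟩ := exists_word_of_closure_eq_top hA g
  rw [hg, List.length_eq_zero_iff] at hlen
  simp [hlen]

theorem wordLength_mul_le (hA : Subgroup.closure A = ⊤) (g h : G) :
    wordLength A (g * h) ≤ wordLength A g + wordLength A h := by
  obtain ⟨v, hv, hvA, hvg⟩ := exists_word_of_closure_eq_top hA g
  obtain ⟨w, hw, hwA, hwh⟩ := exists_word_of_closure_eq_top hA h
  rw [← hv, ← hw, ← List.length_append, ← hvg, ← hwh, ← List.prod_append]
  refine wordLength_prod_le fun x hx => ?_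
  exact (List.mem_append.1 hx).elim (hvA x) (hwA x)

theorem wordLength_inv_le (hA : Subgroup.closure A = ⊤) (g : G) :
    wordLength A g⁻¹ ≤ wordLength A g := by
  obtain ⟨w, hw, hwA, hwg⟩ := exists_word_of_closure_eq_top hA g
  rw [← hw, ← hwg, List.prod_inv_reverse]
  refine (wordLength_prod_le fun x hx => ?_).trans_eq (by simp)
  simp only [List.mem_reverse, List.mem_map] at hx
  obtain ⟨y, hy, rfl⟩ := hx
  simpa [or_comm] using hwA y hy

theorem wordLength_pow_le (hA : Subgroup.closure A = ⊤) (g : G) (n : ℕ) :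
    wordLength A (g ^ n) ≤ n * wordLength A g := by
  induction n with
  | zero => simp [wordLength_one]
  | succ n ih =>
    rw [pow_succ, Nat.succ_mul]
    exact (wordLength_mul_le hA _ _).trans (by gcongr)

theorem wordLength_conj_pow_le (hA : Subgroup.closure A = ⊤) (c u : G) (n : ℕ) :
    wordLength A ((c * u * c⁻¹) ^ n) ≤ n * wordLength A u + 2 * wordLength A c := by
  rw [conj_pow]
  have h₁ := wordLength_mul_le hA (c * u ^ n) c⁻¹
  have h₂ := wordLength_mul_le hA c (u ^ n)
  have h₃ := wordLength_inv_le hA c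
  have h₄ := wordLength_pow_le hA u n
  omega

theorem wordDist_le (hA : Subgroup.closure A = ⊤) (g h : G) :
    wordDist A g h ≤ wordLength A g + wordLength A h := by
  have h₁ := wordLength_mul_le hA g⁻¹ h
  have h₂ := wordLength_inv_le hA g
  unfold wordDist
  omega

theorem finite_setOf_wordLength_le (hfin : A.Finite) (hA : Subgroup.closure A = ⊤) (r : ℕ) :
    {g : G | wordLength A g ≤ r}.Finite := by
  have hS : {x : G | x ∈ A ∨ x⁻¹ ∈ A}.Finite :=
    hfin.union (hfin.preimage inv_injective.injOn)
  have := hS.to_subtype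
  refine ((List.finite_length_le {x : G | x ∈ A ∨ x⁻¹ ∈ A} r).image
    fun w => (w.map Subtype.val).prod).subset fun g hg => ?_
  obtain ⟨w, hw, hwA, rfl⟩ := exists_word_of_closure_eq_top hA g
  refine ⟨w.attach.map fun x => ⟨x.1, hwA x.1 x.2⟩, ?_, ?_⟩
  · simpa [hw] using hg
  · simp [Function.comp_def]

theorem exists_lt_wordLength [Infinite G] (hfin : A.Finite) (hA : Subgroup.closure A = ⊤)
    (r : ℕ) : ∃ g : G, r < wordLength A g := by
  obtain ⟨g, hg⟩ := (finite_setOf_wordLength_le hfin hA r).exists_notMem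
  exact ⟨g, not_le.1 hg⟩

end WordLength

/-- A lower set of `ι → ℕ` is unbounded in every direction in which one of its points exceeds
a uniform threshold. -/
theorem IsLowerSet.exists_forall_add_single_mem {ι : Type*} [Finite ι] [DecidableEq ι]
    {X : Set (ι → ℕ)} (hX : IsLowerSet X) :
    ∃ B : ℕ, ∀ k ∈ X, ∀ j, B ≤ k j → ∀ m, k + Pi.single j m ∈ X := by
  cases nonempty_fintype ι
  have hfin : {p | Minimal (· ∈ Xᶜ) p}.Finite :=
    WellQuasiOrderedLE.finite_of_isAntichain (setOfPred_minimal_antichain _)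
  obtain ⟨b, hb⟩ := hfin.bddAbove
  refine ⟨∑ i, b i, fun k hk j hj m => ?_⟩
  by_contra hm
  obtain ⟨p, hpk, hp⟩ := exists_minimal_le_of_wellFoundedLT (· ∈ Xᶜ) _ hm
  refine hp.prop (hX (fun i => ?_) hk)
  by_cases hij : i = j
  · subst hij
    exact (hb hp i).trans ((Finset.single_le_sum_of_canonicallyOrdered
      (Finset.mem_univ i)).trans hj)
  · simpa [hij] using hpk i

section Geodesic

variable {M ι : Type*} [CommMonoid M] [Fintype ι] (s : ι → M) (l : ι → ℕ)

theorem prod_pow_add_single [DecidableEq ι] (k : ι → ℕ) (j : ι) (m : ℕ) :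
    ∏ i, s i ^ (k + Pi.single j m : ι → ℕ) i = (∏ i, s i ^ k i) * s j ^ m := by
  simp only [Pi.add_apply, pow_add, Finset.prod_mul_distrib]
  congr 1
  rw [Finset.prod_eq_single j (by intro i _ hi; simp [hi]) (by simp), Pi.single_eq_same]

theorem sum_add_single_mul [DecidableEq ι] (k : ι → ℕ) (j : ι) (m : ℕ) :
    ∑ i, (k + Pi.single j m : ι → ℕ) i * l i = ∑ i, k i * l i + m * l j := by
  simp only [Pi.add_apply, add_mul, Finset.sum_add_distrib]
  congr 1
  rw [Finset.sum_eq_single j (by intro i _ hi; simp [hi]) (by simp), Pi.single_eq_same]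

/-- The exponent vectors of least `l`-weight among those representing the same product of
powers of `s`. -/
def geodesicExponents : Set (ι → ℕ) :=
  {k | ∀ k' : ι → ℕ, ∏ i, s i ^ k' i = ∏ i, s i ^ k i → ∑ i, k i * l i ≤ ∑ i, k' i * l i}

theorem isLowerSet_geodesicExponents : IsLowerSet (geodesicExponents s l) := by
  intro k k₀ hle hk k' hk'
  obtain ⟨d, rfl⟩ := exists_add_of_le hle
  have := hk (k' + d) (by simp [pow_add, Finset.prod_mul_distrib, hk'])
  simpa [add_mul, Finset.sum_add_distrib] using this

theorem exists_geodesicExponents (k : ι → ℕ) :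
    ∃ k₀ ∈ geodesicExponents s l, ∏ i, s i ^ k₀ i = ∏ i, s i ^ k i := by
  obtain ⟨k₀, hk₀, hmin⟩ := exists_minimalFor_of_wellFoundedLT
    (fun k' : ι → ℕ => ∏ i, s i ^ k' i = ∏ i, s i ^ k i) (fun k' => ∑ i, k' i * l i) ⟨k, rfl⟩
  refine ⟨k₀, fun k' hk' => ?_, hk₀⟩
  exact (le_total _ _).elim id fun h => hmin (hk'.trans hk₀) h

end Geodesic

section Loops

variable {G : Type*} [Group G] (A : Set G) (N : Subgroup G)

/-- Pairs of a coset of `N` and a nontrivial element of `N` of length at most the index. -/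
def loopIndex : Set ((G ⧸ N) × G) :=
  {p | p.2 ∈ N ∧ p.2 ≠ 1 ∧ wordLength A p.2 ≤ N.index}

variable {A N}

theorem finite_loopIndex [N.FiniteIndex] (hfin : A.Finite) (hA : Subgroup.closure A = ⊤) :
    (loopIndex A N).Finite :=
  (Set.finite_univ.prod (finite_setOf_wordLength_le hfin hA N.index)).subset
    fun _ hp => ⟨Set.mem_univ _, hp.2.2⟩

/-- The conjugate of a short element of `N` by a coset representative. -/
noncomputable def loopConj [hN : N.Normal] (p : loopIndex A N) : N :=
  ⟨p.1.1.out * p.1.2 * p.1.1.out⁻¹, hN.conj_mem _ p.2.1 _⟩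

theorem exists_loop_of_prod_mem [N.FiniteIndex] {w : List G} (hw : w ≠ []) (hN : w.prod ∈ N) :
    ∃ x y z : List G, w = x ++ y ++ z ∧ y ≠ [] ∧ y.length ≤ N.index ∧ y.prod ∈ N := by
  by_cases hlen : w.length ≤ N.index
  · exact ⟨[], w, [], by simp, hw, hlen, hN⟩
  have hcard : Nat.card (G ⧸ N) < Nat.card (Fin (N.index + 1)) := by
    simp [Subgroup.index]
  obtain ⟨p, q, hpq, heq⟩ : ∃ p q : Fin (N.index + 1), p < q ∧
      ((w.take p).prod : G ⧸ N) = (w.take q).prod := by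
    have hinj : ¬ Function.Injective
        fun p : Fin (N.index + 1) => ((w.take p).prod : G ⧸ N) :=
      fun h => hcard.not_ge (Nat.card_le_card_of_injective _ h)
    simp only [Function.Injective, not_forall] at hinj
    obtain ⟨p, q, h, hne⟩ := hinj
    rcases lt_or_gt_of_ne hne with hlt | hlt
    exacts [⟨p, q, hlt, h⟩, ⟨q, p, hlt, h.symm⟩]
  have hpq' : (p : ℕ) < q := hpq
  have hq := q.2
  have htake : w.take q = w.take p ++ (w.drop p).take (q - p) := by
    rw [← List.take_add, Nat.add_sub_cancel' hpq'.le]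
  refine ⟨w.take p, (w.drop p).take (q - p), w.drop q, ?_, ?_, ?_, ?_⟩
  · rw [← htake, List.take_append_drop]
  · rw [← List.length_pos_iff]
    simp only [List.length_take, List.length_drop]
    omega
  · simp only [List.length_take, List.length_drop]
    omega
  · rw [QuotientGroup.eq, htake, List.prod_append, inv_mul_cancel_left] at heq
    exact heq

variable [IsMulCommutative N]

theorem conj_out_eq_conj (x u : G) (hu : u ∈ N) :
    (x : G ⧸ N).out * u * (x : G ⧸ N).out⁻¹ = x * u * x⁻¹ := by
  obtain ⟨n, hn⟩ := QuotientGroup.mk_out_eq_mul N x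
  have hcomm : (n : G) * u = u * n := congrArg Subtype.val (mul_comm n ⟨u, hu⟩)
  rw [hn, mul_assoc x, hcomm]
  group

variable [N.Normal]

theorem exists_exponents_of_prod_mem [N.FiniteIndex] [Fintype (loopIndex A N)] {w : List G}
    (hw : ∀ x ∈ w, x ∈ A ∨ x⁻¹ ∈ A) (hN : w.prod ∈ N) :
    ∃ k : loopIndex A N → ℕ, ∏ i, loopConj i ^ k i = ⟨w.prod, hN⟩ ∧
      ∑ i, k i * wordLength A i.1.2 ≤ w.length := by
  classical
  induction hn : w.length using Nat.strong_induction_on generalizing w with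
  | _ n ih =>
  subst hn
  by_cases hnil : w = []
  · subst hnil
    exact ⟨0, by simp [Subtype.ext_iff], by simp⟩
  obtain ⟨x, y, z, rfl, hy, hylen, hyN⟩ := exists_loop_of_prod_mem hnil hN
  have hypos := List.length_pos_iff.2 hy
  have hconj : x.prod * y.prod * x.prod⁻¹ ∈ N := Subgroup.Normal.conj_mem ‹_› _ hyN _
  have hsplit : (x ++ y ++ z).prod = x.prod * y.prod * x.prod⁻¹ * (x ++ z).prod := by
    simp only [List.prod_append]
    group
  have hxz : (x ++ z).prod ∈ N := by
    rw [hsplit] at hN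
    exact (N.mul_mem_cancel_left hconj).1 hN
  obtain ⟨k, hk, hkw⟩ := ih (x ++ z).length (by simp; omega)
    (fun a ha => hw a (by simp only [List.mem_append] at ha ⊢; tauto)) hxz rfl
  have hyA := wordLength_prod_le (A := A) (w := y) fun a ha => hw a (by simp [ha])
  by_cases hy1 : y.prod = 1
  · refine ⟨k, ?_, hkw.trans (by simp)⟩
    rw [hk]
    simp [hy1]
  let i₀ : loopIndex A N := ⟨((x.prod : G ⧸ N), y.prod), hyN, hy1, hyA.trans hylen⟩
  have hi₀ : loopConj i₀ = ⟨x.prod * y.prod * x.prod⁻¹, hconj⟩ :=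
    Subtype.ext (conj_out_eq_conj _ _ hyN)
  refine ⟨k + Pi.single i₀ 1, ?_, ?_⟩
  · rw [prod_pow_add_single, hk, pow_one, hi₀, mul_comm]
    exact Subtype.ext hsplit.symm
  · rw [sum_add_single_mul]
    simp only [List.length_append, one_mul] at hkw ⊢
    change _ + wordLength A y.prod ≤ _
    omega

theorem wordLength_prod_loopConj_le [Fintype (loopIndex A N)] (hA : Subgroup.closure A = ⊤)
    (k : loopIndex A N → ℕ) :
    wordLength A ((∏ i, loopConj i ^ k i : N) : G) ≤
      ∑ i, k i * wordLength A i.1.2 + ∑ i : loopIndex A N, 2 * wordLength A i.1.1.out := by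
  classical
  rw [← Finset.sum_add_distrib]
  induction (Finset.univ : Finset (loopIndex A N)) using Finset.induction_on with
  | empty => simp [wordLength_one]
  | insert i t hi ih =>
    rw [Finset.prod_insert hi, Finset.sum_insert hi, Subgroup.coe_mul, Subgroup.coe_pow]
    exact (wordLength_mul_le hA _ _).trans
      (Nat.add_le_add (wordLength_conj_pow_le hA _ _ _) ih)

end Loops

/-- The depth is uniformly bounded in an infinite group with an abelian normal subgroup of
finite index. -/
theorem exists_depth_bound {G : Type*} [Group G] [Infinite G] (N : Subgroup G) [N.Normal]
    [N.FiniteIndex] [IsMulCommutative N] {A : Set G} (hfin : A.Finite)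
    (hA : Subgroup.closure A = ⊤) :
    ∃ K : ℕ, ∀ g : G, ∃ h : G, wordLength A g < wordLength A h ∧ wordDist A g h ≤ K := by
  classical
  have := (finite_loopIndex (N := N) hfin hA).fintype
  have := Fintype.ofFinite (G ⧸ N)
  let l : loopIndex A N → ℕ := fun i => wordLength A i.1.2
  obtain ⟨B, hB⟩ :=
    (isLowerSet_geodesicExponents (loopConj (A := A) (N := N)) l).exists_forall_add_single_mem
  let C := ∑ i : loopIndex A N, 2 * wordLength A i.1.1.out
  let T := ∑ q : G ⧸ N, wordLength A q.out
  let S := ∑ i : loopIndex A N, wordLength A (loopConj i : G)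
  let R := ∑ i, B * l i + C + T
  obtain ⟨h₀, hh₀⟩ := exists_lt_wordLength hfin hA R
  refine ⟨R + wordLength A h₀ + (T + (C + T + 1) * S), fun g => ?_⟩
  let c := (g : G ⧸ N).out
  have hc : wordLength A c ≤ T :=
    Finset.single_le_sum_of_canonicallyOrdered (f := fun q : G ⧸ N => wordLength A q.out)
      (Finset.mem_univ _)
  have hv : g * c⁻¹ ∈ N := by
    rw [← QuotientGroup.eq_one_iff, QuotientGroup.mk_mul, QuotientGroup.mk_inv,
      QuotientGroup.out_eq', mul_inv_cancel]
  have hrep : ∀ v : N, ∃ k : loopIndex A N → ℕ, ∏ i, loopConj i ^ k i = v ∧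
      ∑ i, k i * l i ≤ wordLength A (v : G) := by
    rintro ⟨v, hv⟩
    obtain ⟨w, hw, hwA, rfl⟩ := exists_word_of_closure_eq_top hA v
    rw [← hw]
    exact exists_exponents_of_prod_mem hwA hv
  obtain ⟨k', hk', -⟩ := hrep ⟨g * c⁻¹, hv⟩
  obtain ⟨k, hk, hkk'⟩ := exists_geodesicExponents loopConj l k'
  have hkv : ((∏ i, loopConj i ^ k i : N) : G) = g * c⁻¹ := by rw [hkk', hk']
  have hg : wordLength A g ≤ ∑ i, k i * l i + C + T := by
    have h₁ : wordLength A (g * c⁻¹) ≤ ∑ i, k i * l i + C :=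
      hkv ▸ wordLength_prod_loopConj_le hA k
    have h₂ := wordLength_mul_le hA (g * c⁻¹) c
    rw [inv_mul_cancel_right] at h₂
    omega
  by_cases hsmall : ∀ j, k j ≤ B
  · have hsum : ∑ i, k i * l i ≤ ∑ i, B * l i :=
      Finset.sum_le_sum fun i _ => Nat.mul_le_mul_right _ (hsmall i)
    have hd := wordDist_le hA g h₀
    exact ⟨h₀, by omega, by omega⟩
  push Not at hsmall
  obtain ⟨j, hj⟩ := hsmall
  have hgeo := hB k hk j hj.le (C + T + 1)
  have hprod : ∏ i, loopConj i ^ (k + Pi.single j (C + T + 1) : loopIndex A N → ℕ) i =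
      (⟨g * c⁻¹, hv⟩ : N) * loopConj j ^ (C + T + 1) := by
    rw [prod_pow_add_single, hkk', hk']
  have hlj : 1 ≤ l j :=
    Nat.one_le_iff_ne_zero.2 fun h => j.2.2.1 (wordLength_eq_zero hA h)
  have hSj : wordLength A (loopConj j : G) ≤ S :=
    Finset.single_le_sum_of_canonicallyOrdered
      (f := fun i : loopIndex A N => wordLength A (loopConj i : G)) (Finset.mem_univ _)
  refine ⟨g * c⁻¹ * (loopConj j : G) ^ (C + T + 1), ?_, ?_⟩
  · obtain ⟨k₁, hk₁, hk₁le⟩ := hrep ((⟨g * c⁻¹, hv⟩ : N) * loopConj j ^ (C + T + 1))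
    have h₁ := hgeo k₁ (hk₁.trans hprod.symm)
    have h₂ := Nat.mul_le_mul_left (C + T + 1) hlj
    rw [sum_add_single_mul] at h₁
    simp only [Subgroup.coe_mul, Subgroup.coe_pow] at hk₁le
    omega
  · have h₁ := wordLength_mul_le hA c⁻¹ ((loopConj j : G) ^ (C + T + 1))
    have h₂ := wordLength_inv_le hA c
    have h₃ := (wordLength_pow_le hA (loopConj j : G) (C + T + 1)).trans
      (Nat.mul_le_mul_left _ hSj)
    have h₄ : g⁻¹ * (g * c⁻¹ * (loopConj j : G) ^ (C + T + 1)) =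
        c⁻¹ * (loopConj j : G) ^ (C + T + 1) := by group
    rw [wordDist, h₄]
    omega

/-- A euclidean group (a finitely generated group with a finite-index subgroup
isomorphic to `ℤⁿ`, `n ≥ 1`) has a uniform bound on depth with respect to any finite
generating set. -/
theorem stmt1 {G : Type*} [Group G] (n : ℕ) (hn : 1 ≤ n) (H : Subgroup G)
    (hfin : H.index ≠ 0) (hiso : Nonempty (H ≃* Multiplicative (Fin n → ℤ))) :
    ∀ A : Set G, A.Finite → Subgroup.closure A = ⊤ →
      ∃ K : ℕ, ∀ g : G, ∃ h : G,
        wordLength A g < wordLength A h ∧ wordDist A g h ≤ K := by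
  intro A hAfin hA
  obtain ⟨e⟩ := hiso
  have : H.FiniteIndex := ⟨hfin⟩
  have : NeZero n := ⟨Nat.one_le_iff_ne_zero.1 hn⟩
  have : Infinite (Multiplicative (Fin n → ℤ)) := inferInstanceAs (Infinite (Fin n → ℤ))
  have : Infinite H := e.toEquiv.infinite_iff.2 this
  have : Infinite G := Infinite.of_injective _ H.subtype_injective
  have : IsMulCommutative H.normalCore := ⟨⟨fun a b => by
    let f := e.toMonoidHom.comp (Subgroup.inclusion H.normalCore_le)
    have hf : Function.Injective f :=
      e.injective.comp (Subgroup.inclusion_injective H.normalCore_le)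
    exact hf (by rw [map_mul, map_mul, mul_comm])⟩⟩
  exact exists_depth_bound H.normalCore hAfin hA
end

section
/- Let H = ⟨a, b | [a,[a,b]], [b,[a,b]]⟩ be the discrete Heisenberg group, where [x,y] = x⁻¹y⁻¹xy, with word metric d with respect to {a,b}. Let n be a positive integer and i, j, k ∈ ℤ with |i| < n, |j| < n and |k| < n(n+1). Then d(1, a^i b^j [a,b]^k) ≤ 4n+2. -/
/-- The commutator `[x,y] = x⁻¹y⁻¹xy`. -/
def comm' {G : Type*} [Group G] (x y : G) : G := x⁻¹ * y⁻¹ * x * y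

/-- The relators of the discrete Heisenberg group `⟨a,b | [a,[a,b]], [b,[a,b]]⟩`. -/
def heisRels : Set (FreeGroup (Fin 2)) :=
  {comm' (FreeGroup.of 0) (comm' (FreeGroup.of 0) (FreeGroup.of 1)),
   comm' (FreeGroup.of 1) (comm' (FreeGroup.of 0) (FreeGroup.of 1))}

/-- The discrete Heisenberg group. -/
abbrev Heis := PresentedGroup heisRels

/-- The generator `a`. -/
def ha : Heis := PresentedGroup.of 0

/-- The generator `b`. -/
def hb : Heis := PresentedGroup.of 1

/-- `g` is a product of at most `N` elements of `A ∪ A⁻¹`. -/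
def HasWord {G : Type*} [Group G] (A : Set G) (N : ℤ) (g : G) : Prop :=
  ∃ w : List G, (w.length : ℤ) ≤ N ∧ (∀ x ∈ w, x ∈ A ∨ x⁻¹ ∈ A) ∧ w.prod = g

section Word

variable {G : Type*} [Group G] {A : Set G}

theorem HasWord.wordLength_le {N : ℕ} {g : G} (h : HasWord A N g) : wordLength A g ≤ N := by
  obtain ⟨w, hN, hw, rfl⟩ := h
  have : wordLength A w.prod ≤ w.length := Nat.sInf_le ⟨w, rfl, hw, rfl⟩
  exact this.trans (by exact_mod_cast hN)

theorem HasWord.mono {M N : ℤ} {g : G} (h : HasWord A M g) (hMN : M ≤ N) : HasWord A N g := by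
  obtain ⟨w, hM, hw⟩ := h
  exact ⟨w, hM.trans hMN, hw⟩

theorem HasWord.mul {M N : ℤ} {g h : G} (hg : HasWord A M g) (hh : HasWord A N h) :
    HasWord A (M + N) (g * h) := by
  obtain ⟨v, hM, hv, rfl⟩ := hg
  obtain ⟨w, hN, hw, rfl⟩ := hh
  refine ⟨v ++ w, by push_cast [List.length_append]; lia, fun x hx => ?_, List.prod_append⟩
  exact (List.mem_append.1 hx).elim (hv x) (hw x)

theorem HasWord.inv {N : ℤ} {g : G} (hg : HasWord A N g) : HasWord A N g⁻¹ := by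
  obtain ⟨w, hN, hw, rfl⟩ := hg
  refine ⟨(w.map (·⁻¹)).reverse, by simpa using hN, fun x hx => ?_, (List.prod_inv_reverse w).symm⟩
  obtain ⟨y, hy, rfl⟩ : ∃ y ∈ w, y⁻¹ = x := by simpa using hx
  simpa [or_comm] using hw y hy

theorem HasWord.pow {g : G} (hg : g ∈ A ∨ g⁻¹ ∈ A) (m : ℕ) : HasWord A m (g ^ m) :=
  ⟨List.replicate m g, by simp, fun x hx => by rwa [List.eq_of_mem_replicate hx], by simp⟩

theorem HasWord.zpow {g : G} (hg : g ∈ A ∨ g⁻¹ ∈ A) (m : ℤ) : HasWord A |m| (g ^ m) := by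
  obtain ⟨k, rfl | rfl⟩ := m.eq_nat_or_neg
  · simpa using HasWord.pow hg k
  · simpa using (HasWord.pow hg k).inv

end Word

/-- `x` and `y` commute with their commutator `z`. -/
structure HeisTriple {G : Type*} [Group G] (x y z : G) : Prop where
  comm_eq : x * y = y * x * z
  left : Commute x z
  right : Commute y z

namespace HeisTriple

variable {G : Type*} [Group G] {x y z : G}

theorem zpow_mul_zpow (h : HeisTriple x y z) (m n : ℤ) :
    y ^ m * x ^ n = x ^ n * y ^ m * z ^ (-(m * n)) := by
  have h₁ : SemiconjBy y (x * z) x := by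
    rw [SemiconjBy, h.comm_eq, mul_assoc]
  have h₂ : SemiconjBy (x ^ n) (y * z ^ (-n)) y := by
    have := h₁.zpow_right n
    rw [SemiconjBy, h.left.mul_zpow] at this
    rw [SemiconjBy, ← mul_assoc, ← this]
    group
  have h₃ := h₂.zpow_right m
  rw [SemiconjBy, (h.right.zpow_right _).mul_zpow, ← zpow_mul] at h₃
  rw [← h₃, mul_assoc]
  congr 3
  ring

theorem normal_mul (h : HeisTriple x y z) (i j k i' j' k' : ℤ) :
    (x ^ i * y ^ j * z ^ k) * (x ^ i' * y ^ j' * z ^ k') =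
      x ^ (i + i') * y ^ (j + j') * z ^ (k + k' - j * i') := by
  have hx := ((h.left.zpow_left i').zpow_right k).eq
  have hy := ((h.right.zpow_left j').zpow_right k).eq
  have hy' := ((h.right.zpow_left j').zpow_right (-(j * i'))).eq
  calc _ = x ^ i * y ^ j * (z ^ k * x ^ i') * y ^ j' * z ^ k' := by group
    _ = x ^ i * (y ^ j * x ^ i') * (z ^ k * y ^ j') * z ^ k' := by rw [← hx]; group
    _ = x ^ (i + i') * y ^ j * (z ^ (-(j * i')) * y ^ j') * z ^ k * z ^ k' := by
      rw [h.zpow_mul_zpow, ← hy]; group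
    _ = _ := by
      rw [← hy', zpow_add y, sub_eq_add_neg, zpow_add z, zpow_add z]
      simp only [mul_assoc, (Commute.refl z).zpow_zpow _ _ |>.eq]

theorem normal_inv (h : HeisTriple x y z) (i j k : ℤ) :
    (x ^ i * y ^ j * z ^ k)⁻¹ = x ^ (-i) * y ^ (-j) * z ^ (-k - i * j) := by
  rw [inv_eq_iff_mul_eq_one, h.normal_mul]
  ring_nf
  simp

theorem inv_left (h : HeisTriple x y z) : HeisTriple x⁻¹ y z⁻¹ where
  comm_eq := by
    have := h.zpow_mul_zpow 1 (-1)
    simp at this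
    rw [this]; group
  left := h.left.inv_inv
  right := h.right.inv_right

theorem inv_right (h : HeisTriple x y z) : HeisTriple x y⁻¹ z⁻¹ where
  comm_eq := by
    have := h.zpow_mul_zpow (-1) 1
    simp at this
    rw [this]; group
  left := h.left.inv_right
  right := h.right.inv_inv

theorem swap (h : HeisTriple x y z) : HeisTriple y x z⁻¹ where
  comm_eq := by rw [h.comm_eq]; group
  left := h.right.inv_right
  right := h.left.inv_right

variable {A : Set G}

theorem hasWord_of_le (h : HeisTriple x y z) (hx : x ∈ A ∨ x⁻¹ ∈ A) (hy : y ∈ A ∨ y⁻¹ ∈ A)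
    {n i j k : ℤ} (hj : 0 ≤ j) (hji : j ≤ i) (hi : i < n) (hk : 0 ≤ k) (hkn : k < n * (n + 1)) :
    HasWord A (4 * n + 2) (x ^ i * y ^ j * z ^ k) := by
  obtain ⟨s, m, t, his, hsn, hm, hmn, ht, hts, rfl⟩ : ∃ s m t : ℤ, i ≤ s ∧ s ≤ n ∧ 0 ≤ m ∧ m ≤ n ∧
      0 ≤ t ∧ t ≤ s ∧ m * s + t + j * (s - i) = k := by
    rcases le_or_gt (j * (n - i)) k with hc | hc
    · have hn : 0 < n := by lia
      refine ⟨n, (k - j * (n - i)) / n, (k - j * (n - i)) % n, hi.le, le_rfl,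
        Int.ediv_nonneg (by lia) hn.le, ?_, Int.emod_nonneg _ hn.ne', (Int.emod_lt_of_pos _ hn).le, ?_⟩
      · rw [← Int.lt_add_one_iff]
        refine Int.ediv_lt_of_lt_mul hn ?_
        nlinarith [mul_nonneg hj (sub_nonneg.2 hi.le)]
      · linarith [Int.ediv_mul_add_emod (k - j * (n - i)) n]
    · have hj' : 0 < j := by
        rcases hj.eq_or_lt with rfl | h0
        · lia
        · exact h0
      have h₁ : k / j < n - i := Int.ediv_lt_of_lt_mul hj' (by linarith)
      have h₂ := Int.ediv_nonneg hk hj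
      have h₃ := Int.emod_lt_of_pos k hj'
      refine ⟨i + k / j, 0, k % j, by lia, by lia, le_rfl, by lia, Int.emod_nonneg _ hj'.ne',
        by lia, ?_⟩
      linarith [Int.mul_ediv_add_emod k j]
  have key : x ^ i * y ^ j * z ^ (m * s + t + j * (s - i)) =
      y ^ (-m) * x ^ (s - t) * y ^ (-1 : ℤ) * x ^ t * y ^ (m + 1 + j) * x ^ (i - s) := by
    have e₁ (r : ℤ) : x ^ r = x ^ r * y ^ (0 : ℤ) * z ^ (0 : ℤ) := by simp
    have e₂ (r : ℤ) : y ^ r = x ^ (0 : ℤ) * y ^ r * z ^ (0 : ℤ) := by simp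
    rw [e₂ (-m), e₁ (s - t), e₂ (-1), e₁ t, e₂ (m + 1 + j), e₁ (i - s)]
    simp only [h.normal_mul]
    congr 2 <;> ring_nf
  rw [key]
  refine ((((((HasWord.zpow hy _).mul (HasWord.zpow hx _)).mul (HasWord.zpow hy _)).mul
    (HasWord.zpow hx _)).mul (HasWord.zpow hy _)).mul (HasWord.zpow hx _)).mono ?_
  rw [abs_of_nonpos (by lia : -m ≤ 0), abs_of_nonneg (by lia : 0 ≤ s - t),
    abs_of_nonneg ht, abs_of_nonneg (by lia : 0 ≤ m + 1 + j), abs_of_nonpos (by lia : i - s ≤ 0),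
    abs_neg, abs_one]
  lia

theorem hasWord_of_nonneg (h : HeisTriple x y z) (hx : x ∈ A ∨ x⁻¹ ∈ A) (hy : y ∈ A ∨ y⁻¹ ∈ A)
    {n i j k : ℤ} (hi : 0 ≤ i) (hin : i < n) (hj : 0 ≤ j) (hjn : j < n) (hk : 0 ≤ k)
    (hkn : k < n * (n + 1)) : HasWord A (4 * n + 2) (x ^ i * y ^ j * z ^ k) := by
  rcases le_total j i with hji | hij
  · exact h.hasWord_of_le hx hy hj hji hin hk hkn
  · have := (h.swap.inv_left.inv_right.hasWord_of_le (A := A) (by simpa [or_comm] using hy)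
      (by simpa [or_comm] using hx) hi hij hjn hk hkn).inv
    convert this using 1
    have hxz := (h.left.zpow_left i).zpow_right k
    have hyz := (h.right.zpow_left j).zpow_right k
    simp [mul_assoc]
    rw [hyz.eq, ← mul_assoc, hxz.eq, mul_assoc]

theorem hasWord_of_neg (h : HeisTriple x y z) (hx : x ∈ A ∨ x⁻¹ ∈ A) (hy : y ∈ A ∨ y⁻¹ ∈ A)
    {i j k : ℤ} (hj : 0 ≤ j) (hk : k < 0) (hkij : -(i * j) < k) :
    HasWord A (i + j) (x ^ i * y ^ j * z ^ k) := by
  have hi : 0 < i := by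
    by_contra! hi
    nlinarith
  set q := (-k) / i
  set t := (-k) % i
  have hq : 0 ≤ q := Int.ediv_nonneg (by lia) hi.le
  have hqj : q < j := Int.ediv_lt_of_lt_mul hi (by linarith)
  have ht : 0 ≤ t := Int.emod_nonneg _ hi.ne'
  have hti : t < i := Int.emod_lt_of_pos _ hi
  have hkqt : k = -(i * q + t) := by linarith [Int.mul_ediv_add_emod (-k) i]
  have key : x ^ i * y ^ j * z ^ k =
      y ^ q * x ^ (i - t) * y ^ (1 : ℤ) * x ^ t * y ^ (j - q - 1) := by
    have e₁ (r : ℤ) : x ^ r = x ^ r * y ^ (0 : ℤ) * z ^ (0 : ℤ) := by simp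
    have e₂ (r : ℤ) : y ^ r = x ^ (0 : ℤ) * y ^ r * z ^ (0 : ℤ) := by simp
    rw [e₂ q, e₁ (i - t), e₂ 1, e₁ t, e₂ (j - q - 1), hkqt]
    simp only [h.normal_mul]
    congr 2 <;> ring_nf
  rw [key]
  refine (((((HasWord.zpow hy _).mul (HasWord.zpow hx _)).mul (HasWord.zpow hy _)).mul
    (HasWord.zpow hx _)).mul (HasWord.zpow hy _)).mono ?_
  rw [abs_of_nonneg hq, abs_of_nonneg (by lia : 0 ≤ i - t),
    abs_of_nonneg ht, abs_of_nonneg (by lia : 0 ≤ j - q - 1), abs_one]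
  lia

theorem hasWord_of_nonneg_of_nonneg (h : HeisTriple x y z) (hx : x ∈ A ∨ x⁻¹ ∈ A)
    (hy : y ∈ A ∨ y⁻¹ ∈ A) {n i j k : ℤ} (hi : 0 ≤ i) (hin : i < n) (hj : 0 ≤ j) (hjn : j < n)
    (hk : |k| < n * (n + 1)) : HasWord A (4 * n + 2) (x ^ i * y ^ j * z ^ k) := by
  rw [abs_lt] at hk
  rcases le_or_gt 0 k with hk₀ | hk₀
  · exact h.hasWord_of_nonneg hx hy hi hin hj hjn hk₀ hk.2
  rcases le_or_gt k (-(i * j)) with hkij | hkij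
  · have := (h.inv_left.inv_right.hasWord_of_nonneg (A := A) (k := -k - i * j)
      (by simpa [or_comm] using hx) (by simpa [or_comm] using hy) hi hin hj hjn (by linarith)
      (by nlinarith [mul_nonneg hi hj])).inv
    convert this using 1
    rw [h.inv_left.inv_right.normal_inv]
    simp
  · exact (h.hasWord_of_neg hx hy hj hk₀ hkij).mono (by lia)

theorem hasWord (h : HeisTriple x y z) (hx : x ∈ A ∨ x⁻¹ ∈ A) (hy : y ∈ A ∨ y⁻¹ ∈ A)
    {n i j k : ℤ} (hi : |i| < n) (hj : |j| < n) (hk : |k| < n * (n + 1)) :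
    HasWord A (4 * n + 2) (x ^ i * y ^ j * z ^ k) := by
  wlog hi₀ : 0 ≤ i generalizing x z i k
  · simpa using this h.inv_left (by simpa [or_comm] using hx) (i := -i) (k := -k) (by simpa)
      (by simpa) (by lia)
  wlog hj₀ : 0 ≤ j generalizing y z j k
  · simpa using this (y := y⁻¹) (z := z⁻¹) (j := -j) (k := -k) (by simpa [or_comm] using hy)
      (by simpa) h.inv_right (by simpa) (by lia)
  exact h.hasWord_of_nonneg_of_nonneg hx hy hi₀ (lt_of_abs_lt hi) hj₀ (lt_of_abs_lt hj) hk

end HeisTriple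

theorem comm'_eq_one_iff {G : Type*} [Group G] {x y : G} : comm' x y = 1 ↔ Commute x y := by
  rw [comm', mul_assoc, ← mul_inv_rev, inv_mul_eq_one, eq_comm, Commute, SemiconjBy]

theorem map_comm' {G H : Type*} [Group G] [Group H] (f : G →* H) (x y : G) :
    f (comm' x y) = comm' (f x) (f y) := by
  simp [comm']

theorem heisTriple : HeisTriple ha hb (comm' ha hb) where
  comm_eq := by simp [comm', mul_assoc]
  left := by
    rw [← comm'_eq_one_iff]
    have : PresentedGroup.mk heisRels _ = 1 := PresentedGroup.one_of_mem (Or.inl rfl)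
    rwa [map_comm', map_comm'] at this
  right := by
    rw [← comm'_eq_one_iff]
    have : PresentedGroup.mk heisRels _ = 1 := PresentedGroup.one_of_mem (Or.inr rfl)
    rwa [map_comm', map_comm'] at this

/-- In the discrete Heisenberg group, if `|i| < n`, `|j| < n` and `|k| < n(n+1)`,
then `aⁱbʲ[a,b]ᵏ` is within distance `4n+2` of the identity. -/
theorem stmt11 (n : ℕ) (hn : 0 < n) (i j k : ℤ)
    (hi : |i| < (n : ℤ)) (hj : |j| < (n : ℤ)) (hk : |k| < (n : ℤ) * (n + 1)) :
    wordLength {ha, hb} (ha ^ i * hb ^ j * (comm' ha hb) ^ k) ≤ 4 * n + 2 := by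
  exact_mod_cast (heisTriple.hasWord (A := {ha, hb}) (by simp) (by simp) hi hj hk).wordLength_le
end

section
/- Let H = ⟨a, b | [a,[a,b]], [b,[a,b]]⟩ be the discrete Heisenberg group, where [x,y] = x⁻¹y⁻¹xy, with word metric d with respect to {a,b}. For every integer n > 2, the element g_n = [a,b]^{n²+1} is a dead end of depth at least √(2n−4) + 1; that is, d(1, g_n) = 4n+2 and every h ∈ H with d(g_n, h) ≤ √(2n−4) satisfies d(1,h) ≤ 4n+2. -/
/-- Integer triples with the multiplication of upper unitriangular `3 × 3` matrices. -/
@[ext]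
structure HeisTriple_s13 where
  /-- The exponent of `a`. -/
  x : ℤ
  /-- The exponent of `b`. -/
  y : ℤ
  /-- The exponent of the commutator `[a,b]`. -/
  z : ℤ

namespace HeisTriple_s13

instance : Mul HeisTriple_s13 := ⟨fun g h => ⟨g.x + h.x, g.y + h.y, g.z + h.z + g.x * h.y⟩⟩
instance : One HeisTriple_s13 := ⟨⟨0, 0, 0⟩⟩
instance : Inv HeisTriple_s13 := ⟨fun g => ⟨-g.x, -g.y, -g.z + g.x * g.y⟩⟩

@[simp] lemma mul_def (g h : HeisTriple_s13) :
    g * h = ⟨g.x + h.x, g.y + h.y, g.z + h.z + g.x * h.y⟩ := rfl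

lemma one_def : (1 : HeisTriple_s13) = ⟨0, 0, 0⟩ := rfl

@[simp] lemma inv_def (g : HeisTriple_s13) : g⁻¹ = ⟨-g.x, -g.y, -g.z + g.x * g.y⟩ := rfl

instance : Group HeisTriple_s13 :=
  Group.ofLeftAxioms
    (fun g h k => by ext <;> simp <;> ring)
    (fun g => by ext <;> simp [one_def])
    (fun g => by ext <;> simp [one_def])

end HeisTriple_s13

namespace Heis

/-- The homomorphism to the triples sending `a` to `(1, 0, 0)` and `b` to `(0, 1, 0)`. -/
def toTriple : Heis →* HeisTriple_s13 :=
  PresentedGroup.toGroup (f := ![⟨1, 0, 0⟩, ⟨0, 1, 0⟩]) (by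
    rintro r (rfl | rfl) <;> simp [comm', HeisTriple_s13.one_def])

@[simp] lemma toTriple_ha : toTriple ha = ⟨1, 0, 0⟩ := by
  simp [toTriple, ha]

@[simp] lemma toTriple_hb : toTriple hb = ⟨0, 1, 0⟩ := by
  simp [toTriple, hb]

lemma toTriple_comm_pow (k : ℕ) : toTriple (comm' ha hb ^ k) = ⟨0, 0, k⟩ := by
  induction k with
  | zero => simp [HeisTriple_s13.one_def]
  | succ k ih =>
    rw [pow_succ, map_mul, ih]
    simp [comm']

lemma commute_of_comm'_eq_one {G : Type*} [Group G] {g h : G} (hgh : comm' g h = 1) :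
    Commute g h := by
  have h₁ : g⁻¹ * h⁻¹ * (g * h) = 1 := by simpa [comm', mul_assoc] using hgh
  have h₂ : (h * g)⁻¹ = (g * h)⁻¹ := by
    rw [mul_inv_rev h g]; exact eq_inv_of_mul_eq_one_left h₁
  exact (inv_injective h₂).symm

lemma commute_ha_comm : Commute ha (comm' ha hb) :=
  commute_of_comm'_eq_one (PresentedGroup.one_of_mem
    (rels := heisRels) (Set.mem_insert _ _))

lemma commute_hb_comm : Commute hb (comm' ha hb) :=
  commute_of_comm'_eq_one (PresentedGroup.one_of_mem
    (rels := heisRels) (Set.mem_insert_of_mem _ rfl))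

lemma ha_zpow_mul_hb_zpow (x y : ℤ) :
    ha ^ x * hb ^ y = hb ^ y * ha ^ x * comm' ha hb ^ (x * y) := by
  have h₁ : SemiconjBy hb (ha * comm' ha hb) ha := by
    simp [SemiconjBy, comm', mul_assoc]
  have h₂ : ha ^ x * hb = hb * comm' ha hb ^ x * ha ^ x := by
    rw [← (h₁.zpow_right x).eq, commute_ha_comm.mul_zpow, mul_assoc,
      (commute_ha_comm.zpow_zpow x x).eq]
  have h₃ : SemiconjBy (ha ^ x) hb (hb * comm' ha hb ^ x) := h₂
  rw [(h₃.zpow_right y).eq, (commute_hb_comm.zpow_right x).mul_zpow, ← zpow_mul, mul_assoc,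
    mul_assoc, (commute_ha_comm.zpow_zpow x (x * y)).eq]

/-- The element `b ^ y * a ^ x * [a,b] ^ z`. -/
def ofCoords (x y z : ℤ) : Heis := hb ^ y * ha ^ x * comm' ha hb ^ z

lemma ofCoords_mul (x y z x' y' z' : ℤ) :
    ofCoords x y z * ofCoords x' y' z' = ofCoords (x + x') (y + y') (z + z' + x * y') := by
  have hc (g : Heis) (h : Commute g (comm' ha hb)) (m k : ℤ) (t : Heis) :
      comm' ha hb ^ k * (g ^ m * t) = g ^ m * (comm' ha hb ^ k * t) := by
    rw [← mul_assoc, ← (h.zpow_zpow m k).eq, mul_assoc]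
  have hab (t : Heis) : ha ^ x * (hb ^ y' * t) =
      hb ^ y' * (ha ^ x * (comm' ha hb ^ (x * y') * t)) := by
    rw [← mul_assoc, ha_zpow_mul_hb_zpow]; simp only [mul_assoc]
  simp only [ofCoords, mul_assoc, hc hb commute_hb_comm, hc ha commute_ha_comm, hab,
    zpow_add]
  simp only [← zpow_add]
  congr 5
  ring

lemma ofCoords_ha (x : ℤ) : ofCoords x 0 0 = ha ^ x := by simp [ofCoords]

lemma ofCoords_hb (y : ℤ) : ofCoords 0 y 0 = hb ^ y := by simp [ofCoords]

lemma ofCoords_comm (z : ℤ) : ofCoords 0 0 z = comm' ha hb ^ z := by simp [ofCoords]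

/-- A letter is one of the generators or an inverse of one. -/
lemma letter_cases {g : Heis} (hg : g ∈ ({ha, hb} : Set Heis) ∨ g⁻¹ ∈ ({ha, hb} : Set Heis)) :
    g = ha ∨ g = hb ∨ g = ha⁻¹ ∨ g = hb⁻¹ := by
  simpa [inv_eq_iff_eq_inv, or_assoc] using hg

lemma exists_word (g : Heis) :
    ∃ w : List Heis, (∀ t ∈ w, t ∈ ({ha, hb} : Set Heis) ∨ t⁻¹ ∈ ({ha, hb} : Set Heis)) ∧
      w.prod = g := by
  have hr : Set.range (PresentedGroup.of : Fin 2 → Heis) = {ha, hb} := by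
    ext t
    simp [ha, hb, eq_comm]
  have hg : g ∈ (Subgroup.closure ({ha, hb} : Set Heis)).toSubmonoid := by
    rw [← hr, PresentedGroup.closure_range_of]
    trivial
  rw [Subgroup.closure_toSubmonoid] at hg
  exact Submonoid.exists_list_of_mem_closure hg

lemma exists_word_length_eq (g : Heis) :
    ∃ w : List Heis, w.length = wordLength {ha, hb} g ∧
      (∀ t ∈ w, t ∈ ({ha, hb} : Set Heis) ∨ t⁻¹ ∈ ({ha, hb} : Set Heis)) ∧ w.prod = g := by
  obtain ⟨w, hw, hg⟩ := exists_word g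
  exact Nat.sInf_mem (s := {n | ∃ w : List Heis, w.length = n ∧
    (∀ t ∈ w, t ∈ ({ha, hb} : Set Heis) ∨ t⁻¹ ∈ ({ha, hb} : Set Heis)) ∧ w.prod = g})
    ⟨w.length, w, rfl, hw, hg⟩

lemma wordLength_prod_le {w : List Heis}
    (hw : ∀ t ∈ w, t ∈ ({ha, hb} : Set Heis) ∨ t⁻¹ ∈ ({ha, hb} : Set Heis)) :
    wordLength {ha, hb} w.prod ≤ w.length :=
  Nat.sInf_le ⟨w, rfl, hw, rfl⟩

lemma wordLength_mul_le (g h : Heis) :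
    wordLength {ha, hb} (g * h) ≤ wordLength {ha, hb} g + wordLength {ha, hb} h := by
  obtain ⟨v, hv, hvl, rfl⟩ := exists_word_length_eq g
  obtain ⟨w, hw, hwl, rfl⟩ := exists_word_length_eq h
  rw [← hv, ← hw, ← List.prod_append, ← List.length_append]
  refine wordLength_prod_le fun t ht => ?_
  rcases List.mem_append.1 ht with ht | ht
  exacts [hvl t ht, hwl t ht]

lemma wordLength_zpow_le {g : Heis} (hg : g ∈ ({ha, hb} : Set Heis)) (k : ℤ) :
    (wordLength {ha, hb} (g ^ k) : ℤ) ≤ |k| := by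
  obtain ⟨m, rfl | rfl⟩ := k.eq_nat_or_neg
  · have h := wordLength_prod_le (w := List.replicate m g)
      fun t ht => .inl (List.eq_of_mem_replicate ht ▸ hg)
    simpa using h
  · have h := wordLength_prod_le (w := List.replicate m g⁻¹)
      fun t ht => .inr (by rw [List.eq_of_mem_replicate ht, inv_inv]; exact hg)
    simpa using h

lemma wordLength_ha_zpow_le (k : ℤ) : (wordLength {ha, hb} (ha ^ k) : ℤ) ≤ |k| :=
  wordLength_zpow_le (by simp) k

lemma wordLength_hb_zpow_le (k : ℤ) : (wordLength {ha, hb} (hb ^ k) : ℤ) ≤ |k| :=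
  wordLength_zpow_le (by simp) k

lemma wordLength_ofCoords_le_of_hb_first (p i q j r l : ℤ) :
    (wordLength {ha, hb} (ofCoords (i + j + l) (p + q + r) (i * q + (i + j) * r)) : ℤ) ≤
      |p| + |i| + |q| + |j| + |r| + |l| := by
  have h : ofCoords (i + j + l) (p + q + r) (i * q + (i + j) * r) =
      hb ^ p * ha ^ i * hb ^ q * ha ^ j * hb ^ r * ha ^ l := by
    simp only [← ofCoords_ha, ← ofCoords_hb, ofCoords_mul]
    congr 1 <;> ring
  rw [h]
  have h₁ := wordLength_mul_le (hb ^ p * ha ^ i * hb ^ q * ha ^ j * hb ^ r) (ha ^ l)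
  have h₂ := wordLength_mul_le (hb ^ p * ha ^ i * hb ^ q * ha ^ j) (hb ^ r)
  have h₃ := wordLength_mul_le (hb ^ p * ha ^ i * hb ^ q) (ha ^ j)
  have h₄ := wordLength_mul_le (hb ^ p * ha ^ i) (hb ^ q)
  have h₅ := wordLength_mul_le (hb ^ p) (ha ^ i)
  linarith [wordLength_hb_zpow_le p, wordLength_ha_zpow_le i, wordLength_hb_zpow_le q,
    wordLength_ha_zpow_le j, wordLength_hb_zpow_le r, wordLength_ha_zpow_le l]

lemma wordLength_ofCoords_le_of_ha_first (l r j q i p : ℤ) :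
    (wordLength {ha, hb} (ofCoords (l + j + i) (r + q + p)
      (l * r + (l + j) * q + (l + j + i) * p)) : ℤ) ≤
      |l| + |r| + |j| + |q| + |i| + |p| := by
  have h := wordLength_ofCoords_le_of_hb_first 0 l r j q i
  have h' := wordLength_mul_le
    (ofCoords (l + j + i) (0 + r + q) (l * r + (l + j) * q)) (hb ^ p)
  rw [← ofCoords_hb, ofCoords_mul, ofCoords_hb] at h'
  simp only [abs_zero, zero_add, add_zero] at h h'
  linarith [wordLength_hb_zpow_le p]

lemma wordLength_ofCoords_le {n x y z : ℤ} (hn : 0 < n) (hx : |x| ≤ n) (hy : |y| ≤ n)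
    (hz : 0 ≤ z) (hzn : z + |x * y| < n * (n + 1)) :
    (wordLength {ha, hb} (ofCoords x y z) : ℤ) ≤ 4 * n + 2 := by
  have key (W : ℤ) (h₀ : 0 ≤ W) (h₁ : W < n * (n + 1)) :
      ∃ s i : ℤ, W = n * s + i ∧ 0 ≤ s ∧ s ≤ n ∧ 0 ≤ i ∧ i < n :=
    ⟨W / n, W % n, (Int.mul_ediv_add_emod W n).symm, Int.ediv_nonneg h₀ hn.le,
      Int.lt_add_one_iff.1 (Int.ediv_lt_of_lt_mul hn (by linarith)), Int.emod_nonneg _ hn.ne',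
      Int.emod_lt_of_pos _ hn⟩
  have h_abs := abs_nonneg (x * y)
  rcases le_total 0 x with hx0 | hx0 <;> rcases le_total 0 y with hy0 | hy0
  · obtain ⟨s, i, hW, hs0, hsn, hi0, hin⟩ := key z hz (by linarith)
    have h := wordLength_ofCoords_le_of_hb_first (y - (s + 1)) i 1 (n - i) s (x - n)
    have e : ofCoords (i + (n - i) + (x - n)) (y - (s + 1) + 1 + s)
        (i * 1 + (i + (n - i)) * s) = ofCoords x y z := by
      congr 1 <;> linarith
    rw [e] at h
    clear key e hW hz hzn h_abs
    grind
  · rw [abs_of_nonpos (mul_nonpos_of_nonneg_of_nonpos hx0 hy0)] at hzn h_abs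
    obtain ⟨s, i, hW, hs0, hsn, hi0, hin⟩ := key (z + -(x * y)) (by linarith) (by linarith)
    have h := wordLength_ofCoords_le_of_ha_first (x - n) (-s) (n - i) (-1) i (s + 1 + y)
    have e : ofCoords (x - n + (n - i) + i) (-s + -1 + (s + 1 + y))
        ((x - n) * -s + (x - n + (n - i)) * -1 + (x - n + (n - i) + i) * (s + 1 + y)) =
        ofCoords x y z := by
      congr 1 <;> linarith
    rw [e] at h
    clear key e hW hz hzn h_abs
    grind
  · rw [abs_of_nonpos (mul_nonpos_of_nonpos_of_nonneg hx0 hy0)] at hzn h_abs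
    obtain ⟨s, i, hW, hs0, hsn, hi0, hin⟩ := key (z + -(x * y)) (by linarith) (by linarith)
    have h := wordLength_ofCoords_le_of_ha_first (x + n) s (-(n - i)) 1 (-i) (y - (s + 1))
    have e : ofCoords (x + n + -(n - i) + -i) (s + 1 + (y - (s + 1)))
        ((x + n) * s + (x + n + -(n - i)) * 1 + (x + n + -(n - i) + -i) * (y - (s + 1))) =
        ofCoords x y z := by
      congr 1 <;> linarith
    rw [e] at h
    clear key e hW hz hzn h_abs
    grind
  · obtain ⟨s, i, hW, hs0, hsn, hi0, hin⟩ := key z hz (by linarith)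
    have h := wordLength_ofCoords_le_of_hb_first (y + (s + 1)) (-i) (-1) (-(n - i)) (-s) (x + n)
    have e : ofCoords (-i + -(n - i) + (x + n)) (y + (s + 1) + -1 + -s)
        (-i * -1 + (-i + -(n - i)) * -s) = ofCoords x y z := by
      congr 1 <;> linarith
    rw [e] at h
    clear key e hW hz hzn h_abs
    grind

/-- A word with `h` letters `a^±1` and `v` letters `b^±1` has coordinates bounded by `h`, `v`
and `h * v`. -/
lemma exists_coords (w : List Heis)
    (hw : ∀ t ∈ w, t ∈ ({ha, hb} : Set Heis) ∨ t⁻¹ ∈ ({ha, hb} : Set Heis)) :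
    ∃ x y z h v : ℤ, w.prod = ofCoords x y z ∧ |x| ≤ h ∧ |y| ≤ v ∧ |z| ≤ h * v ∧
      h + v = w.length := by
  induction w using List.reverseRecOn with
  | nil => exact ⟨0, 0, 0, 0, 0, by simp [ofCoords]⟩
  | append_singleton w t ih =>
    obtain ⟨x, y, z, h, v, hp, hx, hy, hz, hl⟩ :=
      ih fun u hu => hw u (List.mem_append_left _ hu)
    have hv : 0 ≤ v := (abs_nonneg y).trans hy
    rw [List.prod_append, List.prod_singleton, hp, List.length_append, List.length_singleton,
      Nat.cast_add, Nat.cast_one, ← hl]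
    rw [abs_le] at hx hy hz
    rcases letter_cases (hw t (by simp)) with rfl | rfl | rfl | rfl
    · refine ⟨x + 1, y, z, h + 1, v, ?_, ?_, ?_, ?_, by ring⟩
      · rw [← zpow_one ha, ← ofCoords_ha, ofCoords_mul]; simp
      all_goals rw [abs_le]; constructor <;> linarith
    · refine ⟨x, y + 1, z + x, h, v + 1, ?_, ?_, ?_, ?_, by ring⟩
      · rw [← zpow_one hb, ← ofCoords_hb, ofCoords_mul]; simp
      all_goals rw [abs_le]; constructor <;> linarith
    · refine ⟨x - 1, y, z, h + 1, v, ?_, ?_, ?_, ?_, by ring⟩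
      · rw [← zpow_neg_one ha, ← ofCoords_ha, ofCoords_mul]; simp [sub_eq_add_neg]
      all_goals rw [abs_le]; constructor <;> linarith
    · refine ⟨x, y - 1, z - x, h, v + 1, ?_, ?_, ?_, ?_, by ring⟩
      · rw [← zpow_neg_one hb, ← ofCoords_hb, ofCoords_mul]; simp [sub_eq_add_neg]
      all_goals rw [abs_le]; constructor <;> linarith

/-- The path of a word with `h` letters `a^±1`, `p` letters `b` and `q` letters `b⁻¹` stays in a
strip `m ≤ x ≤ M`, whose width bounds the area. -/
lemma exists_strip (w : List Heis)
    (hw : ∀ t ∈ w, t ∈ ({ha, hb} : Set Heis) ∨ t⁻¹ ∈ ({ha, hb} : Set Heis)) :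
    ∃ x y z h p q m M : ℤ, toTriple w.prod = ⟨x, y, z⟩ ∧ h + p + q = w.length ∧
      0 ≤ p ∧ 0 ≤ q ∧ p - q = y ∧ 2 ∣ h - x ∧ m ≤ 0 ∧ 0 ≤ M ∧ m ≤ x ∧ x ≤ M ∧
      2 * (M - m) - |x| ≤ h ∧ z ≤ M * p - m * q := by
  induction w using List.reverseRecOn with
  | nil => exact ⟨0, 0, 0, 0, 0, 0, 0, 0, by simp [HeisTriple_s13.one_def]⟩
  | append_singleton w t ih =>
    obtain ⟨x, y, z, h, p, q, m, M, hp, hl, hp0, hq0, hpq, h2, hm, hM, hmx, hxM, hh, hz⟩ :=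
      ih fun u hu => hw u (List.mem_append_left _ hu)
    rw [List.prod_append, List.prod_singleton, map_mul, hp, List.length_append,
      List.length_singleton, Nat.cast_add, Nat.cast_one, ← hl]
    rcases letter_cases (hw t (by simp)) with rfl | rfl | rfl | rfl
    · refine ⟨x + 1, y, z, h + 1, p, q, m, max M (x + 1), by simp, by ring, hp0, hq0, hpq,
        by simpa using h2, hm, by grind, by linarith, by grind, by grind, ?_⟩
      nlinarith [le_max_left M (x + 1)]
    · exact ⟨x, y + 1, z + x, h, p + 1, q, m, M, by simp, by ring, by linarith, hq0,
        by linarith, h2, hm, hM, hmx, hxM, hh, by linarith⟩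
    · refine ⟨x - 1, y, z, h + 1, p, q, min m (x - 1), M, by simp [sub_eq_add_neg], by ring,
        hp0, hq0, hpq, by omega, by grind, hM, by grind, by linarith, by grind, ?_⟩
      nlinarith [min_le_left m (x - 1)]
    · exact ⟨x, y - 1, z - x, h, p, q + 1, m, M, by simp [sub_eq_add_neg], by ring, hp0,
        by linarith, by linarith, h2, hm, hM, hmx, hxM, hh, by linarith⟩

lemma le_wordLength_comm_pow (n : ℕ) :
    4 * n + 2 ≤ wordLength {ha, hb} (comm' ha hb ^ (n ^ 2 + 1)) := by
  obtain ⟨w, hl, hw, hg⟩ := exists_word_length_eq (comm' ha hb ^ (n ^ 2 + 1))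
  obtain ⟨x, y, z, h, p, q, m, M, hp, hL, hp0, -, hpq, ⟨r, hr⟩, -, -, -, -, hh, hz⟩ :=
    exists_strip w hw
  rw [hg, toTriple_comm_pow, HeisTriple_s13.mk.injEq] at hp
  obtain ⟨rfl, rfl, rfl⟩ := hp
  obtain rfl : p = q := by linarith
  rw [← hl]
  by_contra! hlt
  rw [abs_zero] at hh
  have hrp : r + p ≤ 2 * n := by omega
  have hMr : M - m ≤ r := by linarith
  push_cast at hz
  nlinarith [mul_le_mul_of_nonneg_right hMr hp0, sq_nonneg (r - p)]

end Heis

open Heis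

/-- For `n > 2`, the element `g_n = [a,b]^{n²+1}` of the discrete Heisenberg group is
a dead end of depth at least `√(2n−4) + 1`: it is at distance `4n+2` from the
identity, and every `h` within distance `√(2n−4)` of it satisfies `d(1,h) ≤ 4n+2`. -/
theorem stmt13 (n : ℕ) (hn : 2 < n) :
    wordLength {ha, hb} ((comm' ha hb) ^ (n ^ 2 + 1)) = 4 * n + 2 ∧
    ∀ h : Heis,
      (wordDist {ha, hb} ((comm' ha hb) ^ (n ^ 2 + 1)) h : ℝ) ≤
        Real.sqrt (2 * n - 4) →
      wordLength {ha, hb} h ≤ 4 * n + 2 := by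
  have hn' : (2 : ℤ) < n := by exact_mod_cast hn
  have hg : comm' ha hb ^ (n ^ 2 + 1) = ofCoords 0 0 ((n : ℤ) ^ 2 + 1) := by
    rw [ofCoords_comm]; exact_mod_cast rfl
  refine ⟨le_antisymm ?_ (le_wordLength_comm_pow n), fun h hd => ?_⟩
  · rw [hg]
    have := wordLength_ofCoords_le (n := n) (x := 0) (y := 0) (z := (n : ℤ) ^ 2 + 1)
      (by linarith) (by simp) (by simp) (by positivity) (by simp; nlinarith)
    exact_mod_cast this
  · obtain ⟨w, hl, hw, hu⟩ := exists_word_length_eq ((comm' ha hb ^ (n ^ 2 + 1))⁻¹ * h)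
    obtain ⟨x, y, z, i, j, hp, hx, hy, hz, hij⟩ := exists_coords w hw
    have hd' : ((w.length : ℤ)) ^ 2 ≤ 2 * n - 4 := by
      have hn₂ : (2 : ℝ) < n := by exact_mod_cast hn
      rw [wordDist, ← hl, Real.le_sqrt (by positivity) (by linarith)] at hd
      exact_mod_cast hd
    rw [← hij] at hd'
    have hi : 0 ≤ i := (abs_nonneg x).trans hx
    have hj : 0 ≤ j := (abs_nonneg y).trans hy
    have hsum : i + j ≤ n := by nlinarith
    have hxy : |x * y| ≤ i * j := by
      rw [abs_mul]; exact mul_le_mul hx hy (abs_nonneg y) hi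
    have hprod : 4 * (i * j) ≤ 2 * n - 4 := by nlinarith [sq_nonneg (i - j)]
    have hh : h = ofCoords x y ((n : ℤ) ^ 2 + 1 + z) := by
      rw [← mul_inv_cancel_left (comm' ha hb ^ (n ^ 2 + 1)) h, ← hu, hp, hg, ofCoords_mul]
      simp
    rw [abs_le] at hz
    have := wordLength_ofCoords_le (n := n) (x := x) (y := y) (z := (n : ℤ) ^ 2 + 1 + z)
      (by linarith) (by linarith) (by linarith) (by nlinarith) (by nlinarith)
    rw [hh]
    exact_mod_cast this
end
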